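/- arXiv:0912.4743 — 2 statements merged into one kernel-verified Lean document; each statement's English description precedes it below -/
import Mathlib

section
/- Let c₁, c₂, α₁, α₂, β₁, β₂ > 0 and λ₁, λ₂ ∈ (0,3), and let π(x) = c₁ e^{−α₁β₁x} (1 − e^{−β₁x})^{−λ₁} for x > 0 and π(x) = c₂ e^{α₂β₂x} (1 − e^{β₂x})^{−λ₂} for x < 0. Then ∫_ℝ min(x², 1) π(x) dx < ∞. In particular, π is the density of a Lévy measure. -/
open MeasureTheory Set

noncomputable section

/-- The density of the Lévy measure of the β-class of Lévy processes:
`π(x) = c₁ e^{−α₁β₁x}/(1 − e^{−β₁x})^{λ₁}` for `x > 0` and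
`π(x) = c₂ e^{α₂β₂x}/(1 − e^{β₂x})^{λ₂}` for `x < 0`. -/
def betaLevyDensity (c₁ c₂ α₁ α₂ β₁ β₂ lam₁ lam₂ : ℝ) (x : ℝ) : ℝ :=
  if 0 < x then c₁ * Real.exp (-(α₁ * β₁ * x)) / (1 - Real.exp (-(β₁ * x))) ^ lam₁
  else if x < 0 then c₂ * Real.exp (α₂ * β₂ * x) / (1 - Real.exp (β₂ * x)) ^ lam₂
  else 0

theorem measurable_betaLevyDensity (c₁ c₂ α₁ α₂ β₁ β₂ lam₁ lam₂ : ℝ) :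
    Measurable (betaLevyDensity c₁ c₂ α₁ α₂ β₁ β₂ lam₁ lam₂) := by
  unfold betaLevyDensity
  refine Measurable.ite measurableSet_Ioi (by fun_prop) ?_
  exact Measurable.ite measurableSet_Iio (by fun_prop) measurable_const

/-- Near the origin `1 - e^{-t}` is comparable to `t`, and the polynomial loss at infinity is
absorbed by an exponential of arbitrarily small rate. -/
theorem exists_inv_one_sub_exp_neg_rpow_le {ε lam : ℝ} (hε : 0 < ε) (hlam : 0 < lam) :
    ∃ K : ℝ, 0 < K ∧ ∀ t : ℝ, 0 < t →
      ((1 - Real.exp (-t)) ^ lam)⁻¹ ≤ K * (t ^ (-lam) * Real.exp (ε * t)) := by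
  set δ := ε / lam
  have hδ : 0 < δ := div_pos hε hlam
  refine ⟨(1 + 1 / δ) ^ lam, by positivity, fun t ht => ?_⟩
  have hpos : 0 < 1 - Real.exp (-t) := by
    have : Real.exp (-t) < 1 := Real.exp_lt_one_iff.2 (by linarith)
    linarith
  have hbase : (1 - Real.exp (-t))⁻¹ ≤ (1 + 1 / δ) * (t⁻¹ * Real.exp (δ * t)) := by
    have hexp : 1 + t ≤ (1 + 1 / δ) * Real.exp (δ * t) := by
      have h := Real.add_one_le_exp (δ * t)
      calc 1 + t ≤ (1 + 1 / δ) * (δ * t + 1) := by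
            have : (1 + 1 / δ) * (δ * t + 1) = 1 + t + (δ * t + 1 / δ) := by
              field_simp
              ring
            rw [this]
            have : 0 < δ * t + 1 / δ := by positivity
            linarith
        _ ≤ _ := by gcongr
    have hinv : (1 - Real.exp (-t))⁻¹ ≤ t⁻¹ * (1 + t) := by
      have hneg : Real.exp (-t) ≤ (1 + t)⁻¹ := by
        rw [Real.exp_neg]
        have := Real.add_one_le_exp t
        gcongr
        linarith
      have hlow : t / (1 + t) ≤ 1 - Real.exp (-t) := by
        have : t / (1 + t) = 1 - (1 + t)⁻¹ := by
          field_simp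
          ring
        linarith
      calc (1 - Real.exp (-t))⁻¹ ≤ (t / (1 + t))⁻¹ := by gcongr
        _ = t⁻¹ * (1 + t) := by field_simp
    calc _ ≤ t⁻¹ * (1 + t) := hinv
      _ ≤ t⁻¹ * ((1 + 1 / δ) * Real.exp (δ * t)) := by gcongr
      _ = _ := by ring
  calc ((1 - Real.exp (-t)) ^ lam)⁻¹ = ((1 - Real.exp (-t))⁻¹) ^ lam :=
        (Real.inv_rpow hpos.le _).symm
    _ ≤ ((1 + 1 / δ) * (t⁻¹ * Real.exp (δ * t))) ^ lam :=
        Real.rpow_le_rpow (by positivity) hbase hlam.le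
    _ = _ := by
        rw [Real.mul_rpow (by positivity) (by positivity),
          Real.mul_rpow (by positivity) (by positivity), Real.inv_rpow ht.le,
          Real.rpow_neg ht.le, ← Real.exp_mul]
        congr 3
        simp only [δ]
        field_simp

theorem lintegral_Ioi_min_sq_one_mul_lt_top {c α β lam : ℝ} (hc : 0 < c) (hα : 0 < α)
    (hβ : 0 < β) (hlam : lam ∈ Ioo (0 : ℝ) 3) :
    ∫⁻ x in Ioi (0 : ℝ), ENNReal.ofReal (min (x ^ 2) 1 *
      (c * Real.exp (-(α * β * x)) / (1 - Real.exp (-(β * x))) ^ lam)) < ⊤ := by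
  obtain ⟨K, hK, hbound⟩ := exists_inv_one_sub_exp_neg_rpow_le (half_pos hα) hlam.1
  have hint : IntegrableOn (fun x : ℝ => c * K * β ^ (-lam) *
      (x ^ (2 - lam) * Real.exp (-(α * β / 2) * x ^ (1 : ℝ)))) (Ioi 0) :=
    (integrableOn_rpow_mul_exp_neg_mul_rpow (by linarith [hlam.2]) one_pos
      (by positivity)).const_mul _
  refine lt_of_le_of_lt (setLIntegral_mono' measurableSet_Ioi fun x hx => ?_)
    hint.lintegral_lt_top
  have hx0 : 0 < x := hx
  refine ENNReal.ofReal_le_ofReal ?_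
  have h := hbound (β * x) (by positivity)
  have hnonneg : 0 ≤ ((1 - Real.exp (-(β * x))) ^ lam)⁻¹ := by
    have : Real.exp (-(β * x)) < 1 := Real.exp_lt_one_iff.2 (by nlinarith)
    have : 0 < 1 - Real.exp (-(β * x)) := by linarith
    positivity
  have hmin : min (x ^ 2) 1 ≤ x ^ 2 := min_le_left _ _
  rw [div_eq_mul_inv]
  calc _ ≤ x ^ 2 * (c * Real.exp (-(α * β * x)) *
          (K * ((β * x) ^ (-lam) * Real.exp (α / 2 * (β * x))))) := by gcongr
    _ = _ := by
        have hexp : Real.exp (-(α * β / 2) * x) =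
            Real.exp (-(α * β * x)) * Real.exp (α / 2 * (β * x)) := by
          rw [← Real.exp_add]
          ring_nf
        rw [Real.rpow_one, hexp, Real.mul_rpow hβ.le hx0.le, sub_eq_add_neg,
          Real.rpow_add hx0, Real.rpow_two]
        ring

theorem lintegral_min_sq_one_mul_betaLevyDensity_lt_top
    {c₁ c₂ α₁ α₂ β₁ β₂ lam₁ lam₂ : ℝ}
    (hc₁ : 0 < c₁) (hc₂ : 0 < c₂) (hα₁ : 0 < α₁) (hα₂ : 0 < α₂)
    (hβ₁ : 0 < β₁) (hβ₂ : 0 < β₂)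
    (hlam₁ : lam₁ ∈ Ioo (0 : ℝ) 3) (hlam₂ : lam₂ ∈ Ioo (0 : ℝ) 3) :
    ∫⁻ x : ℝ, ENNReal.ofReal
      (min (x ^ 2) 1 * betaLevyDensity c₁ c₂ α₁ α₂ β₁ β₂ lam₁ lam₂ x) < ⊤ := by
  rw [← lintegral_add_compl _ (measurableSet_Ioi (a := (0 : ℝ))), compl_Ioi]
  refine ENNReal.add_lt_top.2 ⟨?_, ?_⟩
  · refine lt_of_eq_of_lt (setLIntegral_congr_fun measurableSet_Ioi fun x hx => ?_)
      (lintegral_Ioi_min_sq_one_mul_lt_top hc₁ hα₁ hβ₁ hlam₁)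
    have hx0 : 0 < x := hx
    simp only [betaLevyDensity, if_pos hx0]
  · rw [setLIntegral_congr Iio_ae_eq_Iic.symm]
    have hpre : (Neg.neg : ℝ → ℝ) ⁻¹' Iio 0 = Ioi 0 := by ext; simp
    rw [← (Measure.measurePreserving_neg (volume : Measure ℝ)).setLIntegral_comp_preimage_emb
      (MeasurableEquiv.neg ℝ).measurableEmbedding, hpre]
    refine lt_of_eq_of_lt (setLIntegral_congr_fun measurableSet_Ioi fun x hx => ?_)
      (lintegral_Ioi_min_sq_one_mul_lt_top hc₂ hα₂ hβ₂ hlam₂)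
    have hx0 : 0 < x := hx
    simp only [betaLevyDensity, Left.neg_pos_iff, Left.neg_neg_iff, if_neg hx0.not_gt,
      if_pos hx0, neg_sq, mul_neg]

/-- **The β-class jump density is the density of a Lévy measure:**
`∫_ℝ min(x², 1) π(x) dx < ∞`; in particular, the measure with density `π`
assigns no mass to `{0}` and integrates `min(x², 1)`. -/
theorem betaLevyDensity_is_levy_measure
    (c₁ c₂ α₁ α₂ β₁ β₂ lam₁ lam₂ : ℝ)
    (hc₁ : 0 < c₁) (hc₂ : 0 < c₂) (hα₁ : 0 < α₁) (hα₂ : 0 < α₂)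
    (hβ₁ : 0 < β₁) (hβ₂ : 0 < β₂)
    (hlam₁ : lam₁ ∈ Ioo (0 : ℝ) 3) (hlam₂ : lam₂ ∈ Ioo (0 : ℝ) 3) :
    (∫⁻ x : ℝ, ENNReal.ofReal
        (min (x ^ 2) 1 * betaLevyDensity c₁ c₂ α₁ α₂ β₁ β₂ lam₁ lam₂ x) < ⊤) ∧
    ((volume.withDensity fun x =>
        ENNReal.ofReal (betaLevyDensity c₁ c₂ α₁ α₂ β₁ β₂ lam₁ lam₂ x)) {0} = 0 ∧
      ∫⁻ x : ℝ, ENNReal.ofReal (min (x ^ 2) 1)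
        ∂(volume.withDensity fun x =>
            ENNReal.ofReal (betaLevyDensity c₁ c₂ α₁ α₂ β₁ β₂ lam₁ lam₂ x)) < ⊤) := by
  have hfin := lintegral_min_sq_one_mul_betaLevyDensity_lt_top hc₁ hc₂ hα₁ hα₂ hβ₁ hβ₂
    hlam₁ hlam₂
  refine ⟨hfin, withDensity_absolutelyContinuous _ _ (measure_singleton 0), ?_⟩
  rw [lintegral_withDensity_eq_lintegral_mul _
    (measurable_betaLevyDensity c₁ c₂ α₁ α₂ β₁ β₂ lam₁ lam₂).ennreal_ofReal (by fun_prop)]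
  refine lt_of_eq_of_lt (lintegral_congr fun x => ?_) hfin
  rw [Pi.mul_apply, mul_comm, ENNReal.ofReal_mul (by positivity)]

end
end

section
/- Let c, β > 0, γ ∈ (−∞,0) ∪ (0,1), and α ∈ ℝ with 1 − α + γ > 0 and α ≠ 1. Then for every θ > 0, ∫₀^∞ (1 − e^{−θx}) · c e^{αβx} (e^{βx} − 1)^{−(1+γ)} dx = (c/β) [ B(1−α+γ, −γ) − B(1−α+γ+θ/β, −γ) ], where B(x,y) = Γ(x)Γ(y)/Γ(x+y) is formed from the Gamma function (for γ ∈ (0,1) the value Γ(−γ) is the analytically continued Gamma function at the negative non-integer −γ). Consequently the subordinator with Lévy measure c e^{αβx}(e^{βx}−1)^{−(1+γ)} dx on (0,∞), drift δ ≥ 0 and killing rate k ≥ 0 has Laplace exponent Φ(θ) = k + δθ + (c/β){ B(1−α+γ, −γ) − B(1−α+γ+θ/β, −γ) }. -/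
open MeasureTheory Set

noncomputable section

/-- The Beta function `B(x,y) = Γ(x)Γ(y)/Γ(x+y)` built from the (analytically
continued) real Gamma function. -/
def rBeta (x y : ℝ) : ℝ := Real.Gamma x * Real.Gamma y / Real.Gamma (x + y)

theorem integrableOn_beta {a b : ℝ} (ha : 0 < a) (hb : 0 < b) :
    IntegrableOn (fun u : ℝ ↦ u ^ (a - 1) * (1 - u) ^ (b - 1)) (Ioo 0 1) := by
  have h := Complex.betaIntegral_convergent (u := a) (v := b) (by simpa) (by simpa)
  rw [intervalIntegrable_iff_integrableOn_Ioo_of_le zero_le_one] at h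
  refine IntegrableOn.congr_fun h.re (fun u hu ↦ ?_) measurableSet_Ioo
  have h1 : 0 ≤ 1 - u := by linarith [hu.2]
  rw [RCLike.re_to_complex]
  norm_cast
  rw [← Complex.ofReal_cpow hu.1.le, ← Complex.ofReal_cpow h1, ← Complex.ofReal_mul,
    Complex.ofReal_re]

theorem setIntegral_beta {a b : ℝ} (ha : 0 < a) (hb : 0 < b) :
    ∫ u in Ioo (0 : ℝ) 1, u ^ (a - 1) * (1 - u) ^ (b - 1) = rBeta a b := by
  have h := ProbabilityTheory.beta_eq_betaIntegralReal a b ha hb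
  have hint := Complex.betaIntegral_convergent (u := a) (v := b) (by simpa) (by simpa)
  rw [intervalIntegrable_iff_integrableOn_Ioc_of_le zero_le_one] at hint
  rw [ProbabilityTheory.beta, Complex.betaIntegral,
    intervalIntegral.integral_of_le zero_le_one, ← RCLike.re_to_complex, ← integral_re hint,
    integral_Ioc_eq_integral_Ioo] at h
  rw [rBeta, h]
  refine setIntegral_congr_fun measurableSet_Ioo fun u hu ↦ ?_
  have h1 : 0 ≤ 1 - u := by linarith [hu.2]
  simp only [RCLike.re_to_complex]
  norm_cast
  rw [← Complex.ofReal_cpow hu.1.le, ← Complex.ofReal_cpow h1, ← Complex.ofReal_mul,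
    Complex.ofReal_re]

/-- Recurrence in the second argument; also valid where `Γ (a + v)` has a pole, since there both
sides vanish. -/
theorem mul_rBeta {a v : ℝ} (hv : v ≠ 0) :
    v * rBeta a v = (a + v) * rBeta a (v + 1) := by
  unfold rBeta
  rw [Real.Gamma_add_one hv]
  rcases eq_or_ne (a + v) 0 with h | h
  · simp [h]
  · rw [← add_assoc, Real.Gamma_add_one h]
    field_simp

theorem one_sub_rpow_le {u s : ℝ} (hu : 0 < u) (hu1 : u ≤ 1) (hs : 0 ≤ s) :
    1 - u ^ s ≤ (1 + s) * (1 - u) := by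
  have h := one_add_mul_self_le_rpow_one_add (s := u - 1) (by linarith) (p := 1 + s) (by linarith)
  have h2 : u ^ (1 + s) ≤ u ^ s := Real.rpow_le_rpow_of_exponent_ge hu hu1 (by linarith)
  rw [add_sub_cancel] at h
  linarith

theorem one_sub_rpow_mul_rpow_mul_le {u a b s : ℝ} (hu : u ∈ Ioo (0 : ℝ) 1) (hs : 0 ≤ s) :
    (1 - u ^ s) * (u ^ a * (1 - u) ^ b) ≤ (1 + s) * (u ^ a * (1 - u) ^ (b + 1)) := by
  have h1 : 0 < 1 - u := by linarith [hu.2]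
  have := one_sub_rpow_le hu.1 hu.2.le hs
  have := hu.1
  rw [Real.rpow_add_one h1.ne']
  calc _ ≤ ((1 + s) * (1 - u)) * (u ^ a * (1 - u) ^ b) := by gcongr
    _ = _ := by ring

theorem integrableOn_one_sub_rpow_mul {a v s : ℝ} (ha : 0 < a) (hv : -1 < v) (hs : 0 ≤ s) :
    IntegrableOn (fun u : ℝ ↦ (1 - u ^ s) * (u ^ (a - 1) * (1 - u) ^ (v - 1))) (Ioo 0 1) := by
  have h := (integrableOn_beta ha (b := v + 1) (by linarith)).const_mul (1 + s)
  refine Integrable.mono' h (Measurable.aestronglyMeasurable (by fun_prop)) ?_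
  refine ae_restrict_of_forall_mem measurableSet_Ioo fun u hu ↦ ?_
  have h1 : 0 < 1 - u := by linarith [hu.2]
  have h0 := hu.1
  have h2 : 0 ≤ 1 - u ^ s := by linarith [Real.rpow_le_one hu.1.le hu.2.le hs]
  rw [Real.norm_of_nonneg (by positivity)]
  convert one_sub_rpow_mul_rpow_mul_le (a := a - 1) (b := v - 1) hu hs using 4
  ring

theorem setIntegral_one_sub_rpow_mul_of_pos {a v s : ℝ} (ha : 0 < a) (hv : 0 < v) (hs : 0 ≤ s) :
    ∫ u in Ioo (0 : ℝ) 1, (1 - u ^ s) * (u ^ (a - 1) * (1 - u) ^ (v - 1)) =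
      rBeta a v - rBeta (a + s) v := by
  have has : 0 < a + s := by linarith
  rw [← setIntegral_beta ha hv, ← setIntegral_beta has hv,
    ← integral_sub (integrableOn_beta ha hv) (integrableOn_beta has hv)]
  refine setIntegral_congr_fun measurableSet_Ioo fun u hu ↦ ?_
  have : u ^ (a + s - 1) = u ^ (a - 1) * u ^ s := by rw [← Real.rpow_add hu.1]; ring_nf
  simp only [this]
  ring

open Filter Topology in
theorem setIntegral_deriv_one_sub_rpow_mul {a v s : ℝ} (ha : 0 < a) (hv : -1 < v) (hs : 0 ≤ s) :
    ∫ u in Ioo (0 : ℝ) 1, ((a + v) * (u ^ (a - 1) * (1 - u) ^ (v + 1 - 1))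
        - (a + s + v) * (u ^ (a + s - 1) * (1 - u) ^ (v + 1 - 1))
        - v * ((1 - u ^ s) * (u ^ (a - 1) * (1 - u) ^ (v - 1)))) = 0 := by
  have has : 0 < a + s := by linarith
  have hv1 : 0 < v + 1 := by linarith
  have hint := (((integrableOn_beta ha hv1).const_mul (a + v)).sub
    ((integrableOn_beta has hv1).const_mul (a + s + v))).sub
    ((integrableOn_one_sub_rpow_mul ha hv hs).const_mul v)
  have hderiv : ∀ u ∈ Ioo (0 : ℝ) 1, HasDerivAt
      (fun u : ℝ ↦ (u ^ a - u ^ (a + s)) * (1 - u) ^ v)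
      ((a + v) * (u ^ (a - 1) * (1 - u) ^ (v + 1 - 1))
        - (a + s + v) * (u ^ (a + s - 1) * (1 - u) ^ (v + 1 - 1))
        - v * ((1 - u ^ s) * (u ^ (a - 1) * (1 - u) ^ (v - 1)))) u := by
    intro u hu
    have h1 : 0 < 1 - u := by linarith [hu.2]
    have h := ((Real.hasDerivAt_rpow_const (p := a) (Or.inl hu.1.ne')).sub
      (Real.hasDerivAt_rpow_const (p := a + s) (Or.inl hu.1.ne'))).mul
      (((hasDerivAt_id u).const_sub 1).rpow_const (p := v) (Or.inl h1.ne'))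
    refine h.congr_deriv ?_
    have e1 : u ^ (a + s - 1) = u ^ (a - 1) * u ^ s := by rw [← Real.rpow_add hu.1]; ring_nf
    have e2 : u ^ a = u ^ (a - 1) * u := by rw [← Real.rpow_add_one hu.1.ne']; ring_nf
    have e3 : (1 - u) ^ v = (1 - u) ^ (v - 1) * (1 - u) := by
      rw [← Real.rpow_add_one h1.ne']; ring_nf
    simp only [Pi.sub_apply, id, Real.rpow_add hu.1 a s, e1, add_sub_cancel_right, e3, e2]
    ring
  have hzero : Tendsto (fun u : ℝ ↦ (u ^ a - u ^ (a + s)) * (1 - u) ^ v) (𝓝[>] 0) (𝓝 0) := by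
    have hc : ContinuousAt (fun u : ℝ ↦ (u ^ a - u ^ (a + s)) * (1 - u) ^ v) 0 := by
      refine ((Real.continuousAt_rpow_const _ _ (Or.inr ha.le)).sub
        (Real.continuousAt_rpow_const _ _ (Or.inr has.le))).mul
        (ContinuousAt.rpow_const (by fun_prop) (Or.inl (by norm_num)))
    have := hc.tendsto
    simp only [Real.zero_rpow ha.ne', Real.zero_rpow has.ne', sub_zero, zero_mul] at this
    exact this.mono_left nhdsWithin_le_nhds
  have hone : Tendsto (fun u : ℝ ↦ (u ^ a - u ^ (a + s)) * (1 - u) ^ v) (𝓝[<] 1) (𝓝 0) := by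
    have hc : ContinuousAt (fun u : ℝ ↦ (1 + s) * (u ^ a * (1 - u) ^ (v + 1))) 1 := by
      refine continuousAt_const.mul ((Real.continuousAt_rpow_const _ _ (Or.inr ha.le)).mul
        (ContinuousAt.rpow_const (by fun_prop) (Or.inr hv1.le)))
    have hlim := hc.tendsto
    simp only [sub_self, Real.zero_rpow hv1.ne', mul_zero] at hlim
    have hmem : ∀ᶠ u in 𝓝[<] (1 : ℝ), u ∈ Ioo (0 : ℝ) 1 := Ioo_mem_nhdsLT zero_lt_one
    refine tendsto_of_tendsto_of_tendsto_of_le_of_le' tendsto_const_nhds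
      (hlim.mono_left nhdsWithin_le_nhds) ?_ ?_
    · filter_upwards [hmem] with u hu
      have h1 : 0 < 1 - u := by linarith [hu.2]
      have := Real.rpow_le_rpow_of_exponent_ge hu.1 hu.2.le (by linarith : a ≤ a + s)
      have : 0 ≤ u ^ a - u ^ (a + s) := by linarith
      positivity
    · filter_upwards [hmem] with u hu
      refine le_trans (le_of_eq ?_) (one_sub_rpow_mul_rpow_mul_le hu hs)
      rw [Real.rpow_add hu.1]
      ring
  rw [← integral_Ioc_eq_integral_Ioo, ← intervalIntegral.integral_of_le zero_le_one,
    intervalIntegral.integral_eq_sub_of_hasDerivAt_of_tendsto zero_lt_one hderiv ?_ hzero hone,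
    sub_zero]
  rw [intervalIntegrable_iff_integrableOn_Ioo_of_le zero_le_one]
  exact hint

theorem setIntegral_one_sub_rpow_mul {a v s : ℝ} (ha : 0 < a) (hv : -1 < v) (hv0 : v ≠ 0)
    (hs : 0 ≤ s) :
    ∫ u in Ioo (0 : ℝ) 1, (1 - u ^ s) * (u ^ (a - 1) * (1 - u) ^ (v - 1)) =
      rBeta a v - rBeta (a + s) v := by
  have has : 0 < a + s := by linarith
  have hv1 : 0 < v + 1 := by linarith
  have hA := (integrableOn_beta ha hv1).const_mul (a + v)
  have hB := (integrableOn_beta has hv1).const_mul (a + s + v)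
  have hI := (integrableOn_one_sub_rpow_mul ha hv hs).const_mul v
  have h := setIntegral_deriv_one_sub_rpow_mul ha hv hs
  rw [integral_sub ?_ hI, integral_sub hA hB, integral_const_mul, integral_const_mul,
    integral_const_mul, setIntegral_beta ha hv1, setIntegral_beta has hv1, ← mul_rBeta hv0,
    ← mul_rBeta hv0] at h
  · refine mul_left_cancel₀ hv0 ?_
    linarith
  · exact hA.sub hB

theorem image_exp_neg_mul_Ioi {β : ℝ} (hβ : 0 < β) :
    (fun x : ℝ ↦ Real.exp (-(β * x))) '' Ioi 0 = Ioo 0 1 := by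
  ext u
  constructor
  · rintro ⟨x, hx, rfl⟩
    exact ⟨Real.exp_pos _, Real.exp_lt_one_iff.2 (neg_lt_zero.2 (mul_pos hβ hx))⟩
  · rintro ⟨h0, h1⟩
    refine ⟨-Real.log u / β, div_pos (neg_pos.2 (Real.log_neg h0 h1)) hβ, ?_⟩
    simp only
    rw [mul_div_cancel₀ _ hβ.ne', neg_neg, Real.exp_log h0]

/-- The substitution `u = exp (-β x)`. -/
theorem setIntegral_Ioo_eq_setIntegral_Ioi_exp {β : ℝ} (hβ : 0 < β) (g : ℝ → ℝ) :
    ∫ u in Ioo (0 : ℝ) 1, g u =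
      ∫ x in Ioi (0 : ℝ), β * Real.exp (-(β * x)) * g (Real.exp (-(β * x))) := by
  have hd : ∀ x ∈ Ioi (0 : ℝ), HasDerivWithinAt (fun x : ℝ ↦ Real.exp (-(β * x)))
      (Real.exp (-(β * x)) * -(β * 1)) (Ioi 0) x := fun x _ ↦
    (((hasDerivAt_id x).const_mul β).neg.exp).hasDerivWithinAt
  have hinj : InjOn (fun x : ℝ ↦ Real.exp (-(β * x))) (Ioi 0) := fun x _ y _ hxy ↦ by
    simpa [hβ.ne'] using hxy
  rw [← image_exp_neg_mul_Ioi hβ,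
    integral_image_eq_integral_abs_deriv_smul measurableSet_Ioi hd hinj]
  refine setIntegral_congr_fun measurableSet_Ioi fun x _ ↦ ?_
  simp only [mul_one, mul_neg, abs_neg, smul_eq_mul]
  rw [abs_of_pos (by positivity), mul_comm β (Real.exp _)]

theorem exp_mul_exp_sub_one_rpow {α β γ x : ℝ} (hβ : 0 < β) (hx : 0 < x) :
    Real.exp (α * β * x) * (Real.exp (β * x) - 1) ^ (-(1 + γ)) =
      Real.exp (-(β * x)) * (Real.exp (-(β * x)) ^ (1 - α + γ - 1) *
        (1 - Real.exp (-(β * x))) ^ (-γ - 1)) := by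
  have hlt : Real.exp (-(β * x)) < 1 := Real.exp_lt_one_iff.2 (neg_lt_zero.2 (mul_pos hβ hx))
  have hfac : Real.exp (β * x) - 1 = Real.exp (β * x) * (1 - Real.exp (-(β * x))) := by
    rw [mul_sub, ← Real.exp_add, add_neg_cancel, Real.exp_zero, mul_one]
  rw [hfac, Real.mul_rpow (Real.exp_pos _).le (by linarith), ← Real.exp_mul, ← Real.exp_mul,
    ← mul_assoc, ← mul_assoc, ← Real.exp_add, ← Real.exp_add]
  ring_nf

theorem setIntegral_betaSubordinator {c β γ α θ : ℝ} (hβ : 0 < β)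
    (hγ : γ < 0 ∨ γ ∈ Ioo (0 : ℝ) 1) (hα : 0 < 1 - α + γ) (hθ : 0 < θ) :
    ∫ x in Ioi (0 : ℝ), (1 - Real.exp (-(θ * x))) *
        (c * Real.exp (α * β * x) * (Real.exp (β * x) - 1) ^ (-(1 + γ)))
      = (c / β) * (rBeta (1 - α + γ) (-γ) - rBeta (1 - α + γ + θ / β) (-γ)) := by
  have hs : 0 ≤ θ / β := (div_pos hθ hβ).le
  have hunit : ∫ u in Ioo (0 : ℝ) 1,
      (1 - u ^ (θ / β)) * (u ^ (1 - α + γ - 1) * (1 - u) ^ (-γ - 1)) =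
        rBeta (1 - α + γ) (-γ) - rBeta (1 - α + γ + θ / β) (-γ) := by
    rcases hγ with hγ | ⟨hγ0, hγ1⟩
    · exact setIntegral_one_sub_rpow_mul_of_pos hα (by linarith) hs
    · exact setIntegral_one_sub_rpow_mul hα (by linarith) (neg_ne_zero.2 hγ0.ne') hs
  rw [← hunit, setIntegral_Ioo_eq_setIntegral_Ioi_exp hβ, ← integral_const_mul]
  refine setIntegral_congr_fun measurableSet_Ioi fun x hx ↦ ?_
  have hexp : Real.exp (-(β * x)) ^ (θ / β) = Real.exp (-(θ * x)) := by
    rw [← Real.exp_mul]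
    congr 1
    field_simp
  simp only [hexp]
  rw [mul_assoc c, exp_mul_exp_sub_one_rpow hβ hx]
  field_simp

/-- **Laplace exponent of a β-class subordinator (Proposition 9 of [Kuz]).**
For `c, β > 0`, `γ ∈ (−∞,0) ∪ (0,1)`, `1 − α + γ > 0` and `α ≠ 1`, for every
`θ > 0`,
`∫₀^∞ (1 − e^{−θx}) c e^{αβx}(e^{βx} − 1)^{−(1+γ)} dx
  = (c/β)[B(1−α+γ, −γ) − B(1−α+γ+θ/β, −γ)]`;
consequently the subordinator with this Lévy measure, drift `δ ≥ 0` and killing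
rate `k ≥ 0` has Laplace exponent
`Φ(θ) = k + δθ + (c/β){B(1−α+γ, −γ) − B(1−α+γ+θ/β, −γ)}`. -/
theorem betaSubordinator_laplace_exponent
    (c β γ α δ k : ℝ) (hc : 0 < c) (hβ : 0 < β)
    (hγ : γ < 0 ∨ γ ∈ Ioo (0 : ℝ) 1)
    (hα : 0 < 1 - α + γ) (hα1 : α ≠ 1)
    (hδ : 0 ≤ δ) (hk : 0 ≤ k) :
    (∀ θ : ℝ, 0 < θ →
      ∫ x in Ioi (0 : ℝ),
          (1 - Real.exp (-(θ * x))) *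
            (c * Real.exp (α * β * x) * (Real.exp (β * x) - 1) ^ (-(1 + γ)))
        = (c / β) * (rBeta (1 - α + γ) (-γ) - rBeta (1 - α + γ + θ / β) (-γ))) ∧
    (∀ θ : ℝ, 0 < θ →
      k + δ * θ +
          ∫ x in Ioi (0 : ℝ),
            (1 - Real.exp (-(θ * x))) *
              (c * Real.exp (α * β * x) * (Real.exp (β * x) - 1) ^ (-(1 + γ)))
        = k + δ * θ +
            (c / β) * (rBeta (1 - α + γ) (-γ) - rBeta (1 - α + γ + θ / β) (-γ))) := by
  have h : ∀ θ : ℝ, 0 < θ → _ := fun θ hθ ↦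
    setIntegral_betaSubordinator (c := c) hβ hγ hα hθ
  exact ⟨h, fun θ hθ ↦ by rw [h θ hθ]⟩

end
end
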